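/- Let Y = X ∪ α be the closure of the bouquet X = ⋃_{n≥2} C_n of triangle boundaries C_n through p = (0,0), where α is the segment from (0,0) to (0,1). Then the loop f going up and along α and back (f(t) = (0, 1−|2t−1|)) is null-homotopic in Y, but it is the uniform limit of the loops f_n traversing C_n once, each of which is essential in Y. Hence π₁(Y,p) with the quotient topology is not discrete. -/

import Mathlib

open unitInterval Topology

noncomputable section

/-- The topological fundamental group: path components of the based loop space
(compact-open topology), with the quotient topology. -/
def piTop (Z : Type*) [TopologicalSpace Z] (z : Z) : Type _ :=
  Quotient (pathSetoid (Path z z))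

instance (Z : Type*) [TopologicalSpace Z] (z : Z) : TopologicalSpace (piTop Z z) :=
  instTopologicalSpaceQuotient

/-- The class of a loop in the topological fundamental group. -/
def piMk {Z : Type*} [TopologicalSpace Z] {z : Z} (γ : Path z z) : piTop Z z :=
  Quotient.mk _ γ

/-- The common basepoint `p = (0,0)`. -/
def pp : ℝ × ℝ := (0, 0)

/-- The apex `(1/n, 1)` of the `n`-th triangle. -/
def apex (n : ℕ) : ℝ × ℝ := (1 / (n : ℝ), 1)

/-- The third vertex `(1/n,1) + 10^{-10n}·(n,-1)` of the `n`-th triangle. -/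
def apex' (n : ℕ) : ℝ × ℝ := apex n + (((10 : ℝ) ^ (10 * n))⁻¹) • ((n : ℝ), -1)

/-- The boundary of the `n`-th triangle, i.e. the union of its three edges. -/
def Cset (n : ℕ) : Set (ℝ × ℝ) :=
  segment ℝ pp (apex n) ∪ segment ℝ (apex n) (apex' n) ∪ segment ℝ (apex' n) pp

/-- The bouquet `X = ⋃_{n ≥ 2} C_n`. -/
def Xset : Set (ℝ × ℝ) := ⋃ n ∈ {n : ℕ | 2 ≤ n}, Cset n

/-- The segment `α` from `(0,0)` to `(0,1)`. -/
def alphaSet : Set (ℝ × ℝ) := segment ℝ (0, 0) (0, 1)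

/-- The compactification `Y = X ∪ α`. -/
def Yset : Set (ℝ × ℝ) := Xset ∪ alphaSet

lemma pp_mem_C (n : ℕ) : pp ∈ Cset n := Or.inl (Or.inl (left_mem_segment ℝ _ _))

lemma pp_mem_X : pp ∈ Xset :=
  Set.mem_biUnion (by norm_num : (2 : ℕ) ∈ {n : ℕ | 2 ≤ n}) (pp_mem_C 2)

lemma X_sub_Y : Xset ⊆ Yset := Set.subset_union_left

lemma pp_mem_Y : pp ∈ Yset := X_sub_Y pp_mem_X

/-- The basepoint of `X`. -/
def pX : ↥Xset := ⟨pp, pp_mem_X⟩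

/-- The basepoint of `Y`. -/
def pY : ↥Yset := ⟨pp, pp_mem_Y⟩

/-- The inclusion `X ↪ Y` as a continuous map between subspaces. -/
def jXY : C(↥Xset, ↥Yset) := ⟨Set.inclusion X_sub_Y, continuous_inclusion X_sub_Y⟩

lemma jXY_pX : jXY pX = pY := rfl

lemma vert_mem_Y {s : ℝ} (h0 : 0 ≤ s) (h1 : s ≤ 1) : ((0 : ℝ), s) ∈ Yset := by
  refine Or.inr ⟨1 - s, s, by linarith, h0, by ring, ?_⟩
  simp [Prod.ext_iff]

/-- The loop `f(t) = (0, 1 - |2t - 1|)` going up and down the segment `α`. -/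
def upDown : Path pY pY where
  toFun t := ⟨((0 : ℝ), 1 - |2 * (t : ℝ) - 1|),
    vert_mem_Y
      (by
        rw [sub_nonneg, abs_le]
        constructor <;> [linarith [t.2.1]; linarith [t.2.2]])
      (by have := abs_nonneg (2 * (t : ℝ) - 1); linarith)⟩
  continuous_toFun := by
    apply Continuous.subtype_mk
    continuity
  source' := by
    apply Subtype.ext
    norm_num [pY, pp]
  target' := by
    apply Subtype.ext
    norm_num [pY, pp]

/-- the small number `10^{-10n}` -/
def ee (n : ℕ) : ℝ := ((10 : ℝ) ^ (10 * n))⁻¹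

lemma ee_pos (n : ℕ) : 0 < ee n := by unfold ee; positivity

lemma ee_bound (n : ℕ) (hn : 2 ≤ n) : 2 * (n : ℝ) ^ 3 * ee n ≤ 1 := by
  have h1 : n < 2 ^ n := Nat.lt_two_pow_self
  have h2 : 2 * n ^ 3 ≤ 10 ^ (10 * n) := by
    calc 2 * n ^ 3 ≤ 2 ^ n * (2 ^ n) ^ 3 := by
          gcongr
          calc 2 = 2 ^ 1 := by norm_num
            _ ≤ 2 ^ n := Nat.pow_le_pow_right (by norm_num) (by omega)
      _ = 2 ^ (4 * n) := by ring
      _ ≤ 10 ^ (4 * n) := Nat.pow_le_pow_left (by norm_num) _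
      _ ≤ 10 ^ (10 * n) := Nat.pow_le_pow_right (by norm_num) (by omega)
  have h3 : 2 * (n : ℝ) ^ 3 ≤ 10 ^ (10 * n) := by exact_mod_cast h2
  unfold ee
  rw [mul_inv_le_iff₀ (by positivity)]
  linarith

lemma ee_small (n : ℕ) (hn : 2 ≤ n) : 16 * ee n ≤ 1 := by
  have h := ee_bound n hn
  have hk : (2 : ℝ) ≤ n := by exact_mod_cast hn
  have : (2 : ℝ) ^ 3 ≤ (n : ℝ) ^ 3 := by gcongr
  have := ee_pos n
  nlinarith

/-- the height profile -/
def cc (n : ℕ) (t : ℝ) : ℝ :=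
  min 1 (min ((2 + 1 / (n : ℝ)) * t) ((2 + 1 / (n : ℝ)) * (1 - t)))

/-- the progress along the top edge -/
def ww (n : ℕ) (t : ℝ) : ℝ := max 0 (min 1 (n * ((2 + 1 / (n : ℝ)) * t - 1)))

lemma cw_cases (n : ℕ) (hn : 2 ≤ n) (t : ℝ) (h0 : 0 ≤ t) (h1 : t ≤ 1) :
    (0 ≤ cc n t ∧ cc n t ≤ 1 ∧ 0 ≤ ww n t ∧ ww n t ≤ 1) ∧
    (ww n t = 0 ∨ cc n t = 1 ∨ ww n t = 1) := by
  have hk : (2 : ℝ) ≤ n := by exact_mod_cast hn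
  have hk0 : 0 < 1 / (n : ℝ) := by positivity
  have hkk : (n : ℝ) * (1 / (n : ℝ)) = 1 := by field_simp
  refine ⟨⟨?_, min_le_left _ _, le_max_left _ _, max_le (by norm_num) (min_le_left _ _)⟩, ?_⟩
  · refine le_min (by norm_num) (le_min (by positivity) ?_)
    exact mul_nonneg (by positivity) (by linarith)
  · rcases le_total ((2 + 1 / (n : ℝ)) * t) 1 with h | h
    · left
      apply max_eq_left
      apply (min_le_right _ _).trans
      nlinarith
    · rcases le_total ((2 + 1 / (n : ℝ)) * t) (1 + 1 / (n : ℝ)) with h' | h'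
      · right; left
        apply min_eq_left
        refine le_min h ?_
        linarith
      · right; right
        unfold ww
        rw [min_eq_left, max_eq_right] <;> nlinarith

/-- the point of the loop at time `t` -/
def pt (n : ℕ) (t : ℝ) : ℝ × ℝ :=
  (cc n t * (1 / (n : ℝ) + ww n t * (n * ee n)), cc n t * (1 - ww n t * ee n))

lemma apex'_eq (n : ℕ) : apex' n = (1 / (n : ℝ) + n * ee n, 1 - ee n) := by
  unfold apex' apex ee
  ext <;> simp <;> ring

lemma mem1 (n : ℕ) (z : ℝ × ℝ) : z ∈ segment ℝ pp (apex n) ↔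
    ∃ s : ℝ, 0 ≤ s ∧ s ≤ 1 ∧ z = (s * (1 / n), s) := by
  constructor
  · rintro ⟨a, b, ha, hb, hab, rfl⟩
    exact ⟨b, hb, by linarith, by ext <;> simp [pp, apex]⟩
  · rintro ⟨s, h0, h1, rfl⟩
    exact ⟨1 - s, s, by linarith, h0, by ring, by ext <;> simp [pp, apex]⟩

lemma mem2 (n : ℕ) (z : ℝ × ℝ) : z ∈ segment ℝ (apex n) (apex' n) ↔
    ∃ s : ℝ, 0 ≤ s ∧ s ≤ 1 ∧ z = (1 / n + s * (n * ee n), 1 - s * ee n) := by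
  rw [apex'_eq]
  constructor
  · rintro ⟨a, b, ha, hb, hab, rfl⟩
    obtain rfl : a = 1 - b := by linarith
    exact ⟨b, hb, by linarith, by ext <;> simp [apex] <;> ring⟩
  · rintro ⟨s, h0, h1, rfl⟩
    exact ⟨1 - s, s, by linarith, h0, by ring, by ext <;> simp [apex] <;> ring⟩

lemma mem3 (n : ℕ) (z : ℝ × ℝ) : z ∈ segment ℝ (apex' n) pp ↔
    ∃ s : ℝ, 0 ≤ s ∧ s ≤ 1 ∧ z = (s * (1 / n + n * ee n), s * (1 - ee n)) := by
  rw [apex'_eq]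
  constructor
  · rintro ⟨a, b, ha, hb, hab, rfl⟩
    exact ⟨a, ha, by linarith, by ext <;> simp [pp]⟩
  · rintro ⟨s, h0, h1, rfl⟩
    exact ⟨s, 1 - s, h0, by linarith, by ring, by ext <;> simp [pp]⟩

lemma memC (n : ℕ) (z : ℝ × ℝ) : z ∈ Cset n ↔
    ((∃ s : ℝ, 0 ≤ s ∧ s ≤ 1 ∧ z = (s * (1 / n), s)) ∨
    (∃ s : ℝ, 0 ≤ s ∧ s ≤ 1 ∧ z = (1 / n + s * (n * ee n), 1 - s * ee n))) ∨
    ∃ s : ℝ, 0 ≤ s ∧ s ≤ 1 ∧ z = (s * (1 / n + n * ee n), s * (1 - ee n)) := by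
  rw [Cset, Set.mem_union, Set.mem_union, mem1, mem2, mem3]

lemma pt_mem (n : ℕ) (hn : 2 ≤ n) (t : ℝ) (h0 : 0 ≤ t) (h1 : t ≤ 1) : pt n t ∈ Cset n := by
  obtain ⟨⟨a, b, c, d⟩, h | h | h⟩ := cw_cases n hn t h0 h1
  · rw [memC]; left; left
    exact ⟨cc n t, a, b, by simp [pt, h]⟩
  · rw [memC]; left; right
    exact ⟨ww n t, c, d, by simp [pt, h]⟩
  · rw [memC]; right
    exact ⟨cc n t, a, b, by simp [pt, h]⟩

lemma C_sub_Y (n : ℕ) (hn : 2 ≤ n) : Cset n ⊆ Yset := fun _ hz =>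
  X_sub_Y (Set.mem_biUnion (show n ∈ {n : ℕ | 2 ≤ n} from hn) hz)

lemma pt_surj (n : ℕ) (hn : 2 ≤ n) (z : ℝ × ℝ) (hz : z ∈ Cset n) :
    ∃ t : ℝ, 0 ≤ t ∧ t ≤ 1 ∧ pt n t = z := by
  have hk : (2 : ℝ) ≤ n := by exact_mod_cast hn
  have hk0 : 0 < 1 / (n : ℝ) := by positivity
  have hkk : (n : ℝ) * (1 / (n : ℝ)) = 1 := by field_simp
  set q := 1 / (n : ℝ) with hq
  have key : ∀ T : ℝ, (2 + q) * (T / (2 + q)) = T := fun T => by field_simp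
  have key2 : ∀ T : ℝ, (2 + q) * (1 - T / (2 + q)) = 2 + q - T := fun T => by field_simp
  rw [memC] at hz
  rcases hz with (⟨s, s0, s1, rfl⟩ | ⟨s, s0, s1, rfl⟩) | ⟨s, s0, s1, rfl⟩
  · refine ⟨s / (2 + q), by positivity, by rw [div_le_one (by positivity)]; linarith, ?_⟩
    have hw : ww n (s / (2 + q)) = 0 := by
      unfold ww; rw [← hq, key]
      exact max_eq_left ((min_le_right _ _).trans (by nlinarith))
    have hc : cc n (s / (2 + q)) = s := by
      unfold cc; rw [← hq, key, key2, min_eq_left (a := s) (by linarith), min_eq_right s1]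
    simp only [pt, hw, hc]
    ext <;> simp [hq]
  · refine ⟨(1 + q * s) / (2 + q), by positivity, by rw [div_le_one (by positivity)]; nlinarith, ?_⟩
    have hw : ww n ((1 + q * s) / (2 + q)) = s := by
      unfold ww; rw [← hq, key]
      have : (n : ℝ) * (1 + q * s - 1) = s := by linear_combination s * hkk
      rw [this, min_eq_right s1, max_eq_right s0]
    have hc : cc n ((1 + q * s) / (2 + q)) = 1 := by
      unfold cc; rw [← hq, key, key2]
      exact min_eq_left (le_min (by nlinarith) (by nlinarith))
    simp only [pt, hw, hc]
    ext <;> simp [hq]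
  · refine ⟨(2 + q - s) / (2 + q), div_nonneg (by linarith) (by linarith),
      by rw [div_le_one (by positivity)]; linarith, ?_⟩
    have hw : ww n ((2 + q - s) / (2 + q)) = 1 := by
      unfold ww; rw [← hq, key, min_eq_left (by nlinarith), max_eq_right (by norm_num)]
    have hc : cc n ((2 + q - s) / (2 + q)) = s := by
      unfold cc; rw [← hq, key, key2, min_eq_right (a := 2 + q - s) (by linarith), min_eq_right (by linarith)]
      ring
    simp only [pt, hw, hc]
    ext <;> simp [hq]

lemma cc_zero (n : ℕ) : cc n 0 = 0 := by
  have : (0 : ℝ) ≤ 2 + 1 / (n : ℝ) := by positivity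
  unfold cc
  rw [mul_zero, sub_zero, mul_one, min_eq_left this, min_eq_right (by norm_num)]

lemma cc_one (n : ℕ) : cc n 1 = 0 := by
  have : (0 : ℝ) ≤ 2 + 1 / (n : ℝ) := by positivity
  unfold cc
  rw [sub_self, mul_zero, mul_one, min_eq_right this, min_eq_right (by norm_num)]

lemma cc_cont (n : ℕ) : Continuous (cc n) := by unfold cc; fun_prop
lemma ww_cont (n : ℕ) : Continuous (ww n) := by unfold ww; fun_prop
lemma pt_cont (n : ℕ) : Continuous (pt n) := by
  have := cc_cont n
  have := ww_cont n
  unfold pt; fun_prop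

/-- The loop traversing `C_n`. -/
def gl (n : ℕ) (hn : 2 ≤ n) : Path pY pY where
  toFun t := ⟨pt n t, C_sub_Y n hn (pt_mem n hn t t.2.1 t.2.2)⟩
  continuous_toFun := ((pt_cont n).comp continuous_subtype_val).subtype_mk _
  source' := by
    apply Subtype.ext
    simp [pt, cc_zero, pY, pp]
  target' := by
    apply Subtype.ext
    simp [pt, cc_one, pY, pp]

lemma gl_range (n : ℕ) (hn : 2 ≤ n) :
    (Set.range fun t : I => ((gl n hn t : ℝ × ℝ))) = Cset n := by
  ext z
  constructor
  · rintro ⟨t, rfl⟩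
    exact pt_mem n hn t t.2.1 t.2.2
  · intro hz
    obtain ⟨t, h0, h1, h⟩ := pt_surj n hn z hz
    exact ⟨⟨t, h0, h1⟩, h⟩

lemma gl_dist (n : ℕ) (hn : 2 ≤ n) (t : I) : dist (upDown t) (gl n hn t) ≤ 2 / n := by
  have hk : (2 : ℝ) ≤ n := by exact_mod_cast hn
  have hk0 : 0 < 1 / (n : ℝ) := by positivity
  have hkk : (n : ℝ) * (1 / (n : ℝ)) = 1 := by field_simp
  have he := ee_pos n
  have hb := ee_bound n hn
  have ht0 := t.2.1
  have ht1 := t.2.2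
  obtain ⟨⟨a, b, c, d⟩, -⟩ := cw_cases n hn t ht0 ht1
  change dist ((0 : ℝ), 1 - |2 * (t : ℝ) - 1|) (pt n t) ≤ _
  have h2 : (2 : ℝ) / n = 2 * (1 / n) := by ring
  rw [h2, Prod.dist_eq, Real.dist_eq, Real.dist_eq]
  have hne : n * ee n ≤ 1 / (n : ℝ) := by
    rw [le_div_iff₀ (by linarith)]; nlinarith [mul_pos (pow_pos (by linarith : (0:ℝ) < n) 2) he]
  have hne' : ee n ≤ n * ee n := by nlinarith
  have hwe : ww n t * (n * ee n) ≤ n * ee n := by nlinarith [mul_pos (by linarith : (0:ℝ) < n) he]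
  have hwe0 : 0 ≤ ww n t * (n * ee n) := by positivity
  have hwf : ww n t * ee n ≤ ee n := by nlinarith
  have hwf0 : 0 ≤ ww n t * ee n := by positivity
  have hcf : cc n t * (ww n t * ee n) ≤ ee n := by nlinarith
  have hcf0 : 0 ≤ cc n t * (ww n t * ee n) := by positivity
  have hcl : 1 - |2 * (t : ℝ) - 1| ≤ cc n t := by
    unfold cc
    have h1 := le_abs_self (2 * (t : ℝ) - 1)
    have h2 := neg_abs_le (2 * (t : ℝ) - 1)
    have h3 := abs_nonneg (2 * (t : ℝ) - 1)
    refine le_min (by linarith) (le_min ?_ ?_)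
    · nlinarith
    · nlinarith
  have hcu : cc n t ≤ 1 - |2 * (t : ℝ) - 1| + 1 / n := by
    unfold cc
    rcases abs_cases (2 * (t : ℝ) - 1) with ⟨h, _⟩ | ⟨h, _⟩ <;> rw [h]
    · refine (min_le_right _ _).trans ((min_le_right _ _).trans ?_)
      nlinarith
    · refine (min_le_right _ _).trans ((min_le_left _ _).trans ?_)
      nlinarith
  apply max_le
  · simp only [pt]
    rw [zero_sub, abs_neg, abs_of_nonneg (by positivity)]
    nlinarith
  · simp only [pt]
    rw [abs_le]
    constructor <;> nlinarith

/-- separation: at height `1/2` the set `Y` avoids the open sector of `C_n`. -/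
lemma sector (n : ℕ) (hn : 2 ≤ n) (z : ℝ × ℝ) (hz : z ∈ Yset) (hz2 : z.2 = 1 / 2) :
    n * z.1 - z.2 ≤ 0 ∨ ee n * ((n : ℝ) ^ 2 + 1) ≤ 2 * (n * z.1 - z.2) := by
  have hk : (2 : ℝ) ≤ n := by exact_mod_cast hn
  have he := ee_pos n
  have hb := ee_bound n hn
  have hs := ee_small n hn
  have hkk : (n : ℝ) * (1 / (n : ℝ)) = 1 := by field_simp
  -- it suffices to be on the far side
  have far : (1 / n + n * ee n) * z.2 ≤ (1 - ee n) * z.1 →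
      ee n * ((n : ℝ) ^ 2 + 1) ≤ 2 * (n * z.1 - z.2) := by
    intro h
    rw [hz2] at h ⊢
    have h3 : (n : ℝ) * ((1 / n + n * ee n) * (1 / 2)) ≤ n * ((1 - ee n) * z.1) := by gcongr
    have h4 : (n : ℝ) * ((1 / n + n * ee n) * (1 / 2)) = (1 + n ^ 2 * ee n) / 2 := by
      linear_combination (1 / 2) * hkk
    rw [h4] at h3
    have h5 : 1 / 2 ≤ (n : ℝ) * z.1 := by
      by_contra hcon
      push Not at hcon
      have : (n : ℝ) * ((1 - ee n) * z.1) ≤ (1 - ee n) * (1 / 2) := by nlinarith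
      nlinarith [mul_pos (pow_pos (by linarith : (0:ℝ) < n) 2) he]
    nlinarith
  rcases hz with hz | hz
  · simp only [Xset, Set.mem_iUnion, Set.mem_ofPred_eq] at hz
    obtain ⟨m, hm, hz⟩ := hz
    have hmk : (2 : ℝ) ≤ m := by exact_mod_cast hm
    have hem := ee_pos m
    have hbm := ee_bound m hm
    have hsm := ee_small m hm
    have hmm : (m : ℝ) * (1 / (m : ℝ)) = 1 := by field_simp
    have hm0 : 0 < 1 / (m : ℝ) := by positivity
    have hn0 : 0 < 1 / (n : ℝ) := by positivity
    rw [memC] at hz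
    rcases lt_trichotomy m n with hmn | rfl | hmn
    · right
      apply far
      have hmn' : (m : ℝ) + 1 ≤ n := by exact_mod_cast hmn
      have A : 1 / (n : ℝ) + n * ee n ≤ (1 - ee n) * (1 / m) := by
        have h1 : 1 / (m : ℝ) - 1 / n ≥ 1 / n ^ 2 := by
          rw [ge_iff_le, div_sub_div _ _ (by positivity) (by positivity),
            div_le_div_iff₀ (by positivity) (by positivity)]
          nlinarith
        have h2 : 2 * n * ee n ≤ 1 / (n : ℝ) ^ 2 := by
          rw [le_div_iff₀ (by positivity)]; nlinarith
        have h3 : 1 / (m : ℝ) ≤ 1 := by rw [div_le_one (by linarith)]; linarith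
        nlinarith
      have hme : 0 < m * ee m := by positivity
      have hA0 : 0 < 1 / (n : ℝ) + n * ee n := by positivity
      rcases hz with (⟨s, s0, s1, rfl⟩ | ⟨s, s0, s1, rfl⟩) | ⟨s, s0, s1, rfl⟩
      · simp only
        nlinarith
      · simp only
        have : 0 ≤ (1 - ee n) * (s * (m * ee m)) :=
          mul_nonneg (by linarith) (by positivity)
        have : 0 ≤ (1 / (n : ℝ) + n * ee n) * (s * ee m) := by positivity
        nlinarith
      · simp only
        have h1 : 0 ≤ (1 - ee n) * (m * ee m) :=
          mul_nonneg (by linarith) (by positivity)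
        have h2 : 0 ≤ (1 / (n : ℝ) + n * ee n) * ee m := by positivity
        have h3 : (1 / (n : ℝ) + n * ee n) * (1 - ee m) ≤ (1 - ee n) * (1 / m + m * ee m) := by
          nlinarith
        nlinarith
    · rcases hz with (⟨s, s0, s1, rfl⟩ | ⟨s, s0, s1, rfl⟩) | ⟨s, s0, s1, rfl⟩
      · left
        apply le_of_eq
        simp only
        linear_combination s * hkk
      · exfalso
        simp only at hz2
        nlinarith
      · right
        apply far
        apply le_of_eq
        simp only
        ring
    · left
      have hmn' : (n : ℝ) + 1 ≤ m := by exact_mod_cast hmn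
      have A : (n : ℝ) * (1 / m) ≤ 1 - 1 / m := by
        have : (n + 1) * (1 / (m : ℝ)) ≤ m * (1 / m) := by gcongr
        linarith
      have B : n * (m * ee m) + ee m ≤ 1 / m := by
        rw [le_div_iff₀ (by linarith)]
        have h1 : (n : ℝ) * m ^ 2 ≤ m ^ 3 := by
          have : (n : ℝ) ≤ m := by linarith
          have h : 0 ≤ (m : ℝ) ^ 2 := by positivity
          nlinarith
        have h2 : (m : ℝ) ≤ m ^ 3 := by nlinarith
        nlinarith
      rcases hz with (⟨s, s0, s1, rfl⟩ | ⟨s, s0, s1, rfl⟩) | ⟨s, s0, s1, rfl⟩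
      · simp only
        nlinarith
      · simp only
        nlinarith [mul_nonneg (sub_nonneg.2 s1) (by positivity : 0 ≤ n * (m * ee m) + ee m)]
      · simp only
        nlinarith
  · left
    obtain ⟨a, b, ha, hb', hab, rfl⟩ := hz
    simpa using hb'

/-- the real-valued angle -/
def uu (n : ℕ) (z : ℝ × ℝ) : ℝ :=
  max 0 (min 1 (2 * (n * z.1 - z.2) / (ee n * ((n : ℝ) ^ 2 + 1))))

lemma uu_cont (n : ℕ) : Continuous (uu n) := by
  unfold uu
  fun_prop

/-- the map to the circle -/
def phi (n : ℕ) (z : Yset) : AddCircle (1 : ℝ) :=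
  if z.1.2 ≤ 1 / 2 then ((0 : ℝ) : AddCircle (1 : ℝ)) else ((uu n z.1 : ℝ) : AddCircle (1 : ℝ))

lemma coe_one_eq : ((1 : ℝ) : AddCircle (1 : ℝ)) = ((0 : ℝ) : AddCircle (1 : ℝ)) := by
  rw [AddCircle.coe_period]; rfl

lemma phi_cont (n : ℕ) (hn : 2 ≤ n) : Continuous (phi n) := by
  unfold phi
  refine Continuous.if_le continuous_const ?_ (by fun_prop) continuous_const ?_
  · exact (AddCircle.isCoveringMap_coe (1 : ℝ)).continuous.comp
      ((uu_cont n).comp continuous_subtype_val)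
  · intro z hz
    have he := ee_pos n
    have hD : 0 < ee n * ((n : ℝ) ^ 2 + 1) := by positivity
    rcases sector n hn z.1 z.2 hz with h | h
    · have : uu n z.1 = 0 := by
        apply max_eq_left
        apply (min_le_right _ _).trans
        apply div_nonpos_of_nonpos_of_nonneg (by linarith) hD.le
      rw [this]
    · have : uu n z.1 = 1 := by
        unfold uu
        rw [min_eq_left, max_eq_right (by norm_num)]
        rwa [le_div_iff₀ hD, one_mul]
      rw [this, coe_one_eq]

lemma uu_pt (n : ℕ) (hn : 2 ≤ n) (t : ℝ) :
    uu n (pt n t) = max 0 (min 1 (2 * (cc n t * ww n t))) := by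
  have he := ee_pos n
  have hk : (2 : ℝ) ≤ n := by exact_mod_cast hn
  unfold uu pt
  congr 2
  simp only
  field_simp
  ring

lemma phi_gl (n : ℕ) (hn : 2 ≤ n) (t : I) :
    phi n (gl n hn t) = ((min 1 (2 * ww n t) : ℝ) : AddCircle (1 : ℝ)) := by
  have hs := ee_small n hn
  have he := ee_pos n
  obtain ⟨⟨a, b, c, d⟩, h⟩ := cw_cases n hn t t.2.1 t.2.2
  have e1 : ((gl n hn t : Yset) : ℝ × ℝ) = pt n t := rfl
  unfold phi
  rw [e1, uu_pt n hn]
  split_ifs with hy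
  · simp only [pt] at hy
    rcases h with h | h | h
    · simp [h]
    · rw [h] at hy; nlinarith
    · rw [h, min_eq_left (by norm_num), coe_one_eq]
  · simp only [pt] at hy
    rcases h with h | h | h
    · simp [h]
    · rw [h, one_mul, max_eq_right (le_min (by norm_num) (by linarith))]
    · rw [h] at hy ⊢
      push Not at hy
      have h5 : 1 ≤ 2 * (cc n t * 1) := by nlinarith
      rw [min_eq_left h5, max_eq_right (by norm_num), min_eq_left (by norm_num)]

lemma ww_zero (n : ℕ) : ww n 0 = 0 := by
  unfold ww
  apply max_eq_left
  apply (min_le_right _ _).trans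
  simp

lemma ww_one (n : ℕ) (hn : 2 ≤ n) : ww n 1 = 1 := by
  have hk : (2 : ℝ) ≤ n := by exact_mod_cast hn
  have hk0 : 0 < 1 / (n : ℝ) := by positivity
  unfold ww
  rw [min_eq_left (by nlinarith), max_eq_right (by norm_num)]

lemma gl_essential (n : ℕ) (hn : 2 ≤ n) : ¬ (gl n hn).Homotopic (Path.refl pY) := by
  intro h
  have h1 : (gl n hn).toContinuousMap.HomotopicRel (Path.refl pY).toContinuousMap {0, 1} := h
  have h2 := h1.comp_continuousMap (⟨phi n, phi_cont n hn⟩ : C(Yset, AddCircle (1 : ℝ)))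
  let s : C(I, ℝ) := ⟨fun t => min 1 (2 * ww n t), by
    have := ww_cont n
    fun_prop⟩
  let z : C(I, ℝ) := ContinuousMap.const I 0
  have cov := AddCircle.isCoveringMap_coe (1 : ℝ)
  have hs0 : s 0 = 0 := by simp [s, ww_zero]
  have hs1 : s 1 = 1 := by simp [s, ww_one n hn]
  have h3 := (cov.homotopicRel_iff_comp (f₀ := s) (f₁ := z) (S := {0, 1})
    ⟨0, by simp, by simp [hs0, z]⟩).2 (by
      convert h2 using 1
      · ext t
        exact (phi_gl n hn t).symm
      · ext t
        change ((0 : ℝ) : AddCircle (1 : ℝ)) = phi n pY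
        simp [phi, pY, pp])
  have := h3.fst_eq_snd (x := 1) (by simp)
  rw [hs1] at this
  simp [z] at this

lemma upDown_null : upDown.Homotopic (Path.refl pY) := by
  refine ⟨{ toFun := fun x => ⟨((0 : ℝ), (1 - (x.1 : ℝ)) * (1 - |2 * (x.2 : ℝ) - 1|)), ?_⟩,
            continuous_toFun := ?_, map_zero_left := ?_, map_one_left := ?_, prop' := ?_ }⟩
  · have h1 := x.1.2.1
    have h2 := x.1.2.2
    have h3 : |2 * (x.2 : ℝ) - 1| ≤ 1 := by
      rw [abs_le]
      constructor <;> [linarith [x.2.2.1]; linarith [x.2.2.2]]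
    have h4 := abs_nonneg (2 * (x.2 : ℝ) - 1)
    apply vert_mem_Y
    · exact mul_nonneg (by linarith) (by linarith)
    · nlinarith
  · apply Continuous.subtype_mk
    fun_prop
  · intro t
    apply Subtype.ext
    simp [upDown]
  · intro t
    apply Subtype.ext
    simp [pY, pp]
  · rintro t x (rfl | rfl)
    · apply Subtype.ext
      norm_num [upDown, pY, pp]
    · apply Subtype.ext
      norm_num [upDown, pY, pp]

lemma homotopic_of_joined {Z : Type*} [TopologicalSpace Z] {z : Z} {a b : Path z z}
    (h : Joined a b) : a.Homotopic b := by
  obtain ⟨γ⟩ := h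
  refine ⟨{ toFun := fun x => γ x.1 x.2,
            continuous_toFun := ?_, map_zero_left := ?_, map_one_left := ?_, prop' := ?_ }⟩
  · exact Path.continuous_uncurry_iff.2 γ.continuous
  · intro t; simp
  · intro t; simp
  · rintro t x (rfl | rfl) <;> simp

/-- The sequence of loops. -/
def gseq (n : ℕ) : Path pY pY := if hn : 2 ≤ n then gl n hn else Path.refl pY

lemma gseq_eq (n : ℕ) (hn : 2 ≤ n) : gseq n = gl n hn := dif_pos hn

lemma gseq_tendsto :
    TendstoUniformly (fun n (t : I) => gseq n t) (fun t => upDown t) Filter.atTop := by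
  rw [Metric.tendstoUniformly_iff]
  intro ε hε
  have h := tendsto_const_div_atTop_nhds_zero_nat (2 : ℝ)
  filter_upwards [h.eventually_lt_const hε, Filter.eventually_ge_atTop 2] with n h1 h2 t
  rw [gseq_eq n h2]
  exact (gl_dist n h2 t).trans_lt h1

/-- the loop `upDown` along `α` is null-homotopic in `Y`, and it is
the uniform limit of loops traversing the circles `C_n`, each of which is
essential in `Y`; hence `π₁(Y,p)` is not discrete. -/
theorem upDown_nullhomotopic_uniform_limit_essential_and_pi1_not_discrete :
    upDown.Homotopic (Path.refl pY) ∧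
    (∃ g : ℕ → Path pY pY,
      (∀ n, 2 ≤ n →
        (Set.range fun t : I => ((g n t : ℝ × ℝ))) = Cset n ∧
        ¬ (g n).Homotopic (Path.refl pY)) ∧
      TendstoUniformly (fun n (t : I) => g n t) (fun t => upDown t) Filter.atTop) ∧
    ¬ DiscreteTopology (piTop ↥Yset pY) := by
  refine ⟨upDown_null, ⟨gseq, fun n hn => ?_, gseq_tendsto⟩, ?_⟩
  · rw [gseq_eq n hn]
    exact ⟨gl_range n hn, gl_essential n hn⟩
  · intro hd
    have ht : Filter.Tendsto gseq Filter.atTop (𝓝 upDown) := by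
      have hi : IsInducing ((↑) : Path pY pY → C(I, Yset)) := ⟨rfl⟩
      rw [hi.tendsto_nhds_iff, ContinuousMap.tendsto_iff_tendstoUniformly]
      exact gseq_tendsto
    have hc : Continuous (piMk : Path pY pY → piTop ↥Yset pY) := continuous_quotient_mk'
    have ho : IsOpen (piMk ⁻¹' {piMk upDown} : Set (Path pY pY)) :=
      (isOpen_discrete _).preimage hc
    have hev := ht.eventually (ho.mem_nhds rfl)
    obtain ⟨n, h1, h2⟩ := (hev.and (Filter.eventually_ge_atTop 2)).exists
    have hj : Joined (gseq n) upDown := Quotient.exact h1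
    rw [gseq_eq n h2] at hj
    exact gl_essential n h2 ((homotopic_of_joined hj).trans upDown_null)
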